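/- Let c, c_0, c_1, c_2, … ∈ ℤ_2 with c_i → 0 2-adically, and let f : ℤ_2 → ℤ_2 be defined by the (uniformly convergent) series f(x) = c + Σ_{i=0}^∞ c_i·δ_i(x). Then f is a 1-Lipschitz function that is transitive modulo 2^k for every k ≥ 1 (i.e., an ergodic T-function) if and only if the following conditions hold simultaneously: (1) c ≡ 1 (mod 2); (2) c_0 ≡ 1 (mod 4); (3) |c_i|_2 = 2^{−i} for every i ≥ 1. -/

import Mathlib

open Filter

/-- The map induced by `f : ℤ_[2] → ℤ_[2]` on `ℤ/2^kℤ` (for 1-Lipschitz `f` this is the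
well-defined reduction of `f` modulo `2^k`). -/
noncomputable def inducedMod (f : ℤ_[2] → ℤ_[2]) (k : ℕ) : ZMod (2 ^ k) → ZMod (2 ^ k) :=
  fun z => PadicInt.toZModPow k (f ((z.val : ℤ_[2])))

/-- `f` is transitive modulo `2^k`: the orbit of `0` under the induced map on `ℤ/2^kℤ` is
all of `ℤ/2^kℤ`. -/
def TransitiveMod (f : ℤ_[2] → ℤ_[2]) (k : ℕ) : Prop :=
  ∀ z : ZMod (2 ^ k), ∃ n : ℕ, (inducedMod f k)^[n] 0 = z

/-- The `i`-th digit `δ_i(x) ∈ {0,1} ⊆ ℤ_2` of the 2-adic expansion of `x ∈ ℤ_2`. -/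
noncomputable def dig (i : ℕ) (x : ℤ_[2]) : ℤ_[2] :=
  ((x.appr (i + 1) / 2 ^ i % 2 : ℕ) : ℤ_[2])

open Finset in
/-- The `i`-th binary digit is `1` on half of the numbers below `2 ^ (k + 1)` when `i ≤ k`. -/
theorem sum_range_two_pow_digit {k i : ℕ} (hi : i ≤ k) :
    ∑ m ∈ range (2 ^ (k + 1)), m / 2 ^ i % 2 = 2 ^ k := by
  have split (n : ℕ) : ∑ m ∈ range (2 ^ (n + 1)), m / 2 ^ i % 2 =
      ∑ m ∈ range (2 ^ n), m / 2 ^ i % 2 + ∑ m ∈ range (2 ^ n), (2 ^ n + m) / 2 ^ i % 2 := by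
    rw [pow_succ, mul_two, sum_range_add]
  induction k, hi using Nat.le_induction with
  | base =>
    rw [split, sum_eq_zero, sum_congr rfl (g := fun _ => 1)]
    · simp
    · intro m hm
      rw [Nat.add_div_left _ (by positivity), Nat.div_eq_of_lt (mem_range.mp hm)]
    · intro m hm
      rw [Nat.div_eq_of_lt (mem_range.mp hm), Nat.zero_mod]
  | succ k hik ih =>
    have shift (m : ℕ) : (2 ^ (k + 1) + m) / 2 ^ i % 2 = m / 2 ^ i % 2 := by
      obtain ⟨d, rfl⟩ := Nat.exists_eq_add_of_le hik
      rw [show 2 ^ (i + d + 1) + m = m + 2 ^ i * (2 * 2 ^ d) by ring,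
        Nat.add_mul_div_left _ _ (by positivity), Nat.add_mul_mod_self_left]
    rw [split, sum_congr rfl fun m _ => shift m, ih, pow_succ, mul_two]

/-- Divisibility by `2 ^ n` in terms of the norm. -/
theorem two_pow_dvd_iff_norm_le (n : ℕ) (x : ℤ_[2]) :
    (2 : ℤ_[2]) ^ n ∣ x ↔ ‖x‖ ≤ (2 : ℝ) ^ (-(n : ℤ)) := by
  have := PadicInt.norm_le_pow_iff_mem_span_pow x n
  rw [Ideal.mem_span_singleton] at this
  exact_mod_cast this.symm

theorem two_pow_dvd_sub_appr (n : ℕ) (x : ℤ_[2]) : (2 : ℤ_[2]) ^ n ∣ x - (x.appr n : ℤ_[2]) := by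
  simpa [Ideal.mem_span_singleton] using PadicInt.appr_spec n x

theorem two_pow_dvd_natCast_sub (n a b : ℕ) :
    (2 : ℤ_[2]) ^ n ∣ (a : ℤ_[2]) - b ↔ a ≡ b [MOD 2 ^ n] := by
  have := PadicInt.pow_p_dvd_int_iff (p := 2) n (a - b)
  push_cast at this
  rw [this, Nat.modEq_iff_dvd, ← dvd_neg]
  simp

theorem toZModPow_eq_iff (n : ℕ) (x y : ℤ_[2]) :
    PadicInt.toZModPow n x = PadicInt.toZModPow n y ↔ (2 : ℤ_[2]) ^ n ∣ x - y := by
  rw [← sub_eq_zero, ← map_sub, ← RingHom.mem_ker, PadicInt.ker_toZModPow,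
    Ideal.mem_span_singleton]
  simp

/-- A digit can be read off from any natural number that is close enough. -/
theorem dig_eq_of_dvd {i k : ℕ} (hi : i < k) {x : ℤ_[2]} {m : ℕ}
    (h : (2 : ℤ_[2]) ^ k ∣ x - m) : dig i x = ((m / 2 ^ i % 2 : ℕ) : ℤ_[2]) := by
  have h1 : x.appr (i + 1) ≡ m [MOD 2 ^ (i + 1)] := by
    rw [← two_pow_dvd_natCast_sub]
    have := ((pow_dvd_pow 2 hi).trans h).sub (two_pow_dvd_sub_appr (i + 1) x)
    simpa using this
  have h2 : x.appr (i + 1) / 2 ^ i % 2 = m / 2 ^ i % 2 := by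
    rw [← Nat.mod_mul_right_div_self, ← Nat.mod_mul_right_div_self, ← pow_succ, h1]
  rw [dig, h2]

theorem dig_congr {i k : ℕ} (hi : i < k) {x y : ℤ_[2]} (h : (2 : ℤ_[2]) ^ k ∣ x - y) :
    dig i x = dig i y := by
  have hy := two_pow_dvd_sub_appr k y
  rw [dig_eq_of_dvd hi hy, dig_eq_of_dvd hi (m := y.appr k)]
  simpa using h.add hy

theorem dig_natCast (i m : ℕ) : dig i (m : ℤ_[2]) = ((m / 2 ^ i % 2 : ℕ) : ℤ_[2]) :=
  dig_eq_of_dvd (Nat.lt_succ_self i) (by simp)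

theorem dig_zero (i : ℕ) : dig i 0 = 0 := by
  simpa using dig_natCast i 0

theorem dig_two_pow (i j : ℕ) : dig j (2 ^ i) = if j = i then 1 else 0 := by
  have := dig_natCast j (2 ^ i)
  push_cast at this
  rw [this]
  split_ifs with h
  · subst h; simp
  · obtain h | h := lt_or_gt_of_ne h
    · obtain ⟨d, rfl⟩ := Nat.exists_eq_add_of_lt h
      rw [Nat.pow_div (by omega) (by norm_num), show j + d + 1 - j = d + 1 by omega, pow_succ]
      simp
    · rw [Nat.div_eq_of_lt (Nat.pow_lt_pow_right (by norm_num) h)]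
      simp

open Finset in
theorem two_pow_dvd_sub_sum_dig (k : ℕ) (x : ℤ_[2]) :
    (2 : ℤ_[2]) ^ k ∣ x - ∑ i ∈ range k, 2 ^ i * dig i x := by
  have hx := two_pow_dvd_sub_appr k x
  rw [sum_congr rfl fun i hi => by rw [dig_eq_of_dvd (mem_range.mp hi) hx]]
  have h (m : ℕ) : ∑ i ∈ range k, 2 ^ i * (m / 2 ^ i % 2) = m % 2 ^ k := by
    induction k with
    | zero => simp [Nat.mod_one]
    | succ k ih => rw [sum_range_succ, ih (two_pow_dvd_sub_appr k x), Nat.mod_pow_succ]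
  have h' := congrArg (Nat.cast : ℕ → ℤ_[2]) (h (x.appr k))
  rw [Nat.mod_eq_of_lt (PadicInt.appr_lt x k)] at h'
  push_cast at h' ⊢
  rwa [h']

/-- Every 2-adic integer is even or odd. -/
theorem two_dvd_or_two_dvd_sub_one (x : ℤ_[2]) : (2 : ℤ_[2]) ∣ x ∨ (2 : ℤ_[2]) ∣ x - 1 := by
  have h := two_pow_dvd_sub_appr 1 x
  have hlt := PadicInt.appr_lt x 1
  rw [pow_one] at h hlt
  interval_cases x.appr 1
  · left; simpa using h
  · right; simpa using h

theorem not_two_dvd_one : ¬ (2 : ℤ_[2]) ∣ 1 := by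
  have := PadicInt.norm_lt_one_iff_dvd (p := 2) 1
  simpa using this

theorem two_pow_succ_dvd_sub_of_dvd {n : ℕ} {x : ℤ_[2]} (h : (2 : ℤ_[2]) ^ n ∣ x)
    (h' : ¬ (2 : ℤ_[2]) ^ (n + 1) ∣ x) : (2 : ℤ_[2]) ^ (n + 1) ∣ x - 2 ^ n := by
  obtain ⟨y, rfl⟩ := h
  rw [pow_succ] at h' ⊢
  rw [← mul_sub_one]
  exact mul_dvd_mul_left _ ((two_dvd_or_two_dvd_sub_one y).resolve_left
    fun hy => h' (mul_dvd_mul_left _ hy))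

theorem not_two_pow_succ_dvd_two_pow (n : ℕ) : ¬ (2 : ℤ_[2]) ^ (n + 1) ∣ 2 ^ n := fun h => by
  rw [pow_dvd_pow_iff (by norm_num) (by simpa using not_two_dvd_one ∘ isUnit_iff_dvd_one.mp)] at h
  omega

theorem norm_eq_two_zpow_neg_iff (n : ℕ) (x : ℤ_[2]) :
    ‖x‖ = (2 : ℝ) ^ (-(n : ℤ)) ↔ (2 : ℤ_[2]) ^ (n + 1) ∣ x - 2 ^ n := by
  have h2 : ‖(2 : ℤ_[2]) ^ n‖ = (2 : ℝ) ^ (-(n : ℤ)) := by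
    simpa using PadicInt.norm_p_pow (p := 2) n
  have hlt : (2 : ℝ) ^ (-((n + 1 : ℕ) : ℤ)) < (2 : ℝ) ^ (-(n : ℤ)) :=
    zpow_lt_zpow_right₀ one_lt_two (by push_cast; omega)
  constructor
  · intro h
    refine two_pow_succ_dvd_sub_of_dvd ((two_pow_dvd_iff_norm_le _ _).mpr h.le) fun h' => ?_
    rw [two_pow_dvd_iff_norm_le, h] at h'
    exact h'.not_gt hlt
  · intro h
    rw [two_pow_dvd_iff_norm_le] at h
    have h' := IsUltrametricDist.norm_eq_of_add_norm_lt_max (x := x) (y := -2 ^ n) <| by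
      rw [← sub_eq_add_neg, norm_neg, h2]
      exact lt_max_of_lt_right (h.trans_lt hlt)
    rw [h', norm_neg, h2]

theorem norm_le_norm_of_forall_two_pow_dvd {x y : ℤ_[2]}
    (h : ∀ n : ℕ, (2 : ℤ_[2]) ^ n ∣ x → (2 : ℤ_[2]) ^ n ∣ y) : ‖y‖ ≤ ‖x‖ := by
  obtain rfl | hx := eq_or_ne x 0
  · have : y = 0 := by
      by_contra hy
      have h1 := (two_pow_dvd_iff_norm_le (y.valuation + 1) y).mp (h _ (dvd_zero _))
      have h2 := PadicInt.norm_le_pow_iff_le_valuation y hy (y.valuation + 1)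
      push_cast at h1 h2
      have := h2.mp h1
      omega
    simp [this]
  · have h1 := PadicInt.norm_eq_zpow_neg_valuation hx
    push_cast at h1
    rw [h1, ← two_pow_dvd_iff_norm_le]
    exact h _ ((two_pow_dvd_iff_norm_le _ _).mpr h1.le)

open Finset in
/-- If `2 ^ n` divides all coefficients from index `n` on, then modulo `2 ^ n` the digit series is
determined by its first `n` terms. -/
theorem two_pow_dvd_sub_partial_sum {c : ℤ_[2]} {cc : ℕ → ℤ_[2]} (hcc : Tendsto cc atTop (nhds 0))
    {f : ℤ_[2] → ℤ_[2]} (hf : ∀ x : ℤ_[2], f x = c + ∑' i : ℕ, cc i * dig i x)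
    {n : ℕ} (hn : ∀ i, n ≤ i → (2 : ℤ_[2]) ^ n ∣ cc i) (x : ℤ_[2]) :
    (2 : ℤ_[2]) ^ n ∣ f x - (c + ∑ i ∈ range n, cc i * dig i x) := by
  have hs : Summable fun i => cc i * dig i x := by
    refine NonarchimedeanAddGroup.summable_of_tendsto_cofinite_zero ?_
    rw [Nat.cofinite_eq_atTop]
    refine squeeze_zero_norm (fun i => ?_) (tendsto_zero_iff_norm_tendsto_zero.mp hcc)
    rw [norm_mul]
    exact mul_le_of_le_one_right (norm_nonneg _) (PadicInt.norm_le_one _)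
  rw [hf, ← hs.sum_add_tsum_nat_add n, ← add_assoc, add_sub_cancel_left, two_pow_dvd_iff_norm_le]
  refine IsUltrametricDist.norm_tsum_le_of_forall_le fun i => ?_
  rw [← two_pow_dvd_iff_norm_le]
  exact (hn _ (Nat.le_add_left n i)).mul_right _

/-- A 1-Lipschitz map respects congruences modulo powers of two. -/
theorem two_pow_dvd_map_sub_map {f : ℤ_[2] → ℤ_[2]} (hL : ∀ a b : ℤ_[2], ‖f a - f b‖ ≤ ‖a - b‖)
    {n : ℕ} {a b : ℤ_[2]} (h : (2 : ℤ_[2]) ^ n ∣ a - b) : (2 : ℤ_[2]) ^ n ∣ f a - f b := by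
  rw [two_pow_dvd_iff_norm_le] at h ⊢
  exact (hL a b).trans h

theorem semiconj_inducedMod {f : ℤ_[2] → ℤ_[2]} (hL : ∀ a b : ℤ_[2], ‖f a - f b‖ ≤ ‖a - b‖)
    (k : ℕ) : Function.Semiconj (PadicInt.toZModPow k) f (inducedMod f k) := fun x => by
  refine (toZModPow_eq_iff _ _ _).mpr (two_pow_dvd_map_sub_map hL ?_)
  rw [← toZModPow_eq_iff]
  simp

/-- Transitivity of a 1-Lipschitz map modulo `2 ^ k` in terms of the orbit of `0` in `ℤ_[2]`. -/
theorem transitiveMod_iff {f : ℤ_[2] → ℤ_[2]} (hL : ∀ a b : ℤ_[2], ‖f a - f b‖ ≤ ‖a - b‖)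
    (k : ℕ) : TransitiveMod f k ↔ ∀ z : ℤ_[2], ∃ n : ℕ, (2 : ℤ_[2]) ^ k ∣ f^[n] 0 - z := by
  have key (n : ℕ) (z : ℤ_[2]) :
      (inducedMod f k)^[n] 0 = PadicInt.toZModPow k z ↔ (2 : ℤ_[2]) ^ k ∣ f^[n] 0 - z := by
    rw [← toZModPow_eq_iff, ((semiconj_inducedMod hL k).iterate_right n).eq, map_zero]
  simp only [← key, TransitiveMod]
  exact ⟨fun h z => h _, fun h z => by simpa using h (z.val : ℤ_[2])⟩

/-- A 1-Lipschitz map that is transitive modulo all powers of two is injective modulo each. -/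
theorem two_pow_dvd_sub_of_transitiveMod {f : ℤ_[2] → ℤ_[2]}
    (hL : ∀ a b : ℤ_[2], ‖f a - f b‖ ≤ ‖a - b‖) (hT : ∀ k : ℕ, 1 ≤ k → TransitiveMod f k)
    {k : ℕ} {a b : ℤ_[2]} (h : (2 : ℤ_[2]) ^ k ∣ f a - f b) : (2 : ℤ_[2]) ^ k ∣ a - b := by
  have hsurj : Function.Surjective (inducedMod f k) := fun z => by
    obtain ⟨x, rfl⟩ : ∃ x, PadicInt.toZModPow k x = z := ⟨(z.val : ℤ_[2]), by simp⟩
    by_cases hx : (2 : ℤ_[2]) ^ (k + 1) ∣ x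
    · obtain ⟨n, hn⟩ := (transitiveMod_iff hL _).mp (hT (k + 1) (by omega)) (x + 2 ^ k)
      cases n with
      | zero =>
        refine absurd ?_ (not_two_pow_succ_dvd_two_pow k)
        simpa using (hn.add hx).neg_right
      | succ n =>
        refine ⟨PadicInt.toZModPow k (f^[n] 0), ?_⟩
        rw [← (semiconj_inducedMod hL k).eq, toZModPow_eq_iff, ← Function.iterate_succ_apply' f]
        convert ((pow_dvd_pow 2 k.le_succ).trans hn).add (dvd_refl _) using 1
        ring
    · obtain ⟨n, hn⟩ := (transitiveMod_iff hL _).mp (hT (k + 1) (by omega)) x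
      cases n with
      | zero => exact absurd (by simpa using hn) hx
      | succ n =>
        refine ⟨PadicInt.toZModPow k (f^[n] 0), ?_⟩
        rw [← (semiconj_inducedMod hL k).eq, toZModPow_eq_iff, ← Function.iterate_succ_apply' f]
        exact (pow_dvd_pow 2 k.le_succ).trans hn
  have hinj := Finite.injective_iff_surjective.mpr hsurj
  rw [← toZModPow_eq_iff] at h ⊢
  apply hinj
  rwa [← (semiconj_inducedMod hL k).eq, ← (semiconj_inducedMod hL k).eq]

theorem coeff_conditions_of_ergodic {c : ℤ_[2]} {cc : ℕ → ℤ_[2]}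
    (hcc : Tendsto cc atTop (nhds 0))
    {f : ℤ_[2] → ℤ_[2]} (hf : ∀ x : ℤ_[2], f x = c + ∑' i : ℕ, cc i * dig i x)
    (hL : ∀ a b : ℤ_[2], ‖f a - f b‖ ≤ ‖a - b‖) (hT : ∀ k : ℕ, 1 ≤ k → TransitiveMod f k) :
    (2 : ℤ_[2]) ∣ c - 1 ∧ (4 : ℤ_[2]) ∣ cc 0 - 1 ∧
      ∀ i : ℕ, (2 : ℤ_[2]) ^ (i + 1) ∣ cc i - 2 ^ i := by
  have hf0 : f 0 = c := by simp [hf, dig_zero]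
  have hfpow (i : ℕ) : f (2 ^ i) - f 0 = cc i := by
    rw [hf0, hf, tsum_eq_single i (fun j hj => by simp [dig_two_pow, hj])]
    simp [dig_two_pow]
  have hdvd (i : ℕ) : (2 : ℤ_[2]) ^ i ∣ cc i := by
    rw [← hfpow]
    exact two_pow_dvd_map_sub_map hL (by simp)
  have hexact (i : ℕ) : (2 : ℤ_[2]) ^ (i + 1) ∣ cc i - 2 ^ i := by
    refine two_pow_succ_dvd_sub_of_dvd (hdvd i) fun h => not_two_pow_succ_dvd_two_pow i ?_
    rw [← hfpow] at h
    simpa using two_pow_dvd_sub_of_transitiveMod hL hT h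
  have hc : (2 : ℤ_[2]) ∣ c - 1 := by
    refine (two_dvd_or_two_dvd_sub_one c).resolve_left fun h => not_two_dvd_one ?_
    have horb (n : ℕ) : (2 : ℤ_[2]) ∣ f^[n] 0 := by
      induction n with
      | zero => simp
      | succ n ih =>
        rw [Function.iterate_succ_apply']
        have := two_pow_dvd_map_sub_map hL (n := 1) (a := f^[n] 0) (b := 0) (by simpa using ih)
        simpa [hf0] using this.add (by simpa using h : (2 : ℤ_[2]) ^ 1 ∣ c)
    obtain ⟨n, hn⟩ := (transitiveMod_iff hL 1).mp (hT 1 le_rfl) 1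
    rw [pow_one] at hn
    simpa only [sub_sub_cancel] using (horb n).sub hn
  refine ⟨hc, ?_, hexact⟩
  by_contra h4
  have hfc : (2 : ℤ_[2]) ^ 2 ∣ f c := by
    have h1 := two_pow_dvd_sub_partial_sum hcc hf (n := 2)
      (fun i hi => (pow_dvd_pow 2 hi).trans (hdvd i)) c
    have h2 := two_pow_dvd_sub_sum_dig 2 c
    have hd : dig 0 c = 1 := by
      rw [dig_congr one_pos (y := 1) (by simpa using hc)]
      simpa using dig_two_pow 0 0
    have hd1 : (2 : ℤ_[2]) ^ 2 ∣ (cc 1 - 2) * dig 1 c := by simpa using (hexact 1).mul_right _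
    obtain ⟨u, hu⟩ := hc
    obtain ⟨v, hv⟩ : (2 : ℤ_[2]) ∣ cc 0 - 1 := by simpa using hexact 0
    have hvodd : (2 : ℤ_[2]) ∣ v - 1 := by
      refine (two_dvd_or_two_dvd_sub_one v).resolve_left fun ⟨w, hw⟩ => h4 ⟨w, ?_⟩
      rw [hv, hw]; ring
    obtain ⟨w, hw⟩ := hvodd
    simp only [Finset.sum_range_succ, Finset.sum_range_zero, hd] at h1 h2
    obtain ⟨p, hp⟩ := h1
    obtain ⟨q, hq⟩ := h2
    obtain ⟨r, hr⟩ := hd1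
    exact ⟨p + r - q + u + w + 1, by linear_combination hp + hr - hq + hv + 2 * hw + 2 * hu⟩
  have horb (n : ℕ) : (2 : ℤ_[2]) ^ 2 ∣ f^[n] 0 ∨ (2 : ℤ_[2]) ^ 2 ∣ f^[n] 0 - c := by
    induction n with
    | zero => simp
    | succ n ih =>
      rw [Function.iterate_succ_apply']
      obtain h | h := ih
      · right
        rw [← hf0]
        exact two_pow_dvd_map_sub_map hL (by simpa using h)
      · left
        simpa using (two_pow_dvd_map_sub_map hL h).add hfc
  obtain ⟨n, hn⟩ := (transitiveMod_iff hL 2).mp (hT 2 one_le_two) 2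
  obtain h | h := horb n
  · have := h.sub hn
    exact not_two_pow_succ_dvd_two_pow 1 (by simpa using this)
  · obtain ⟨u, hu⟩ := hc
    obtain ⟨v, hv⟩ := hn.sub h
    exact not_two_dvd_one ⟨2 * v + 1 - u, by linear_combination hv - hu⟩

section Converse

variable {c : ℤ_[2]} {cc : ℕ → ℤ_[2]} {f : ℤ_[2] → ℤ_[2]}

/-- If `2 ^ i` exactly divides `cc i`, then `x ↦ f x - x` is strictly contracting. -/
theorem two_pow_succ_dvd_sub_sub (hcc : Tendsto cc atTop (nhds 0))
    (hf : ∀ x : ℤ_[2], f x = c + ∑' i : ℕ, cc i * dig i x)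
    (hexact : ∀ i : ℕ, (2 : ℤ_[2]) ^ (i + 1) ∣ cc i - 2 ^ i)
    (n : ℕ) (x : ℤ_[2]) :
    (2 : ℤ_[2]) ^ (n + 1) ∣
      f x - x - (c + ∑ i ∈ Finset.range n, (cc i - 2 ^ i) * dig i x) := by
  have h1 := two_pow_dvd_sub_partial_sum hcc hf (n := n + 1) (fun i hi => by
    have := ((pow_dvd_pow 2 i.le_succ).trans (hexact i)).add (dvd_refl (2 ^ i))
    rw [sub_add_cancel] at this
    exact (pow_dvd_pow 2 hi).trans this) x
  have h2 := two_pow_dvd_sub_sum_dig (n + 1) x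
  have h3 := (hexact n).mul_right (dig n x)
  convert (h1.sub h2).add h3 using 1
  rw [Finset.sum_range_succ, Finset.sum_range_succ]
  simp only [sub_mul, Finset.sum_sub_distrib]
  ring

theorem two_pow_succ_dvd_displacement_sub (hcc : Tendsto cc atTop (nhds 0))
    (hf : ∀ x : ℤ_[2], f x = c + ∑' i : ℕ, cc i * dig i x)
    (hexact : ∀ i : ℕ, (2 : ℤ_[2]) ^ (i + 1) ∣ cc i - 2 ^ i)
    {n : ℕ} {a b : ℤ_[2]} (h : (2 : ℤ_[2]) ^ n ∣ a - b) :
    (2 : ℤ_[2]) ^ (n + 1) ∣ (f a - f b) - (a - b) := by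
  have ha := two_pow_succ_dvd_sub_sub hcc hf hexact n a
  have hb := two_pow_succ_dvd_sub_sub hcc hf hexact n b
  rw [Finset.sum_congr rfl fun i hi => by rw [dig_congr (Finset.mem_range.mp hi) h]] at ha
  convert ha.sub hb using 1
  ring

theorem two_pow_dvd_sub_of_coeff (hcc : Tendsto cc atTop (nhds 0))
    (hf : ∀ x : ℤ_[2], f x = c + ∑' i : ℕ, cc i * dig i x)
    (hexact : ∀ i : ℕ, (2 : ℤ_[2]) ^ (i + 1) ∣ cc i - 2 ^ i)
    {n : ℕ} {a b : ℤ_[2]} (h : (2 : ℤ_[2]) ^ n ∣ a - b) : (2 : ℤ_[2]) ^ n ∣ f a - f b := by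
  simpa using ((pow_dvd_pow 2 n.le_succ).trans
    (two_pow_succ_dvd_displacement_sub hcc hf hexact h)).add h

theorem two_pow_succ_dvd_iterate_displacement_sub (hcc : Tendsto cc atTop (nhds 0))
    (hf : ∀ x : ℤ_[2], f x = c + ∑' i : ℕ, cc i * dig i x)
    (hexact : ∀ i : ℕ, (2 : ℤ_[2]) ^ (i + 1) ∣ cc i - 2 ^ i)
    {n : ℕ} {a b : ℤ_[2]} (h : (2 : ℤ_[2]) ^ n ∣ a - b) (m : ℕ) :
    (2 : ℤ_[2]) ^ (n + 1) ∣ (f^[m] a - f^[m] b) - (a - b) := by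
  induction m generalizing a b with
  | zero => simp
  | succ m ih =>
    rw [Function.iterate_succ_apply, Function.iterate_succ_apply]
    have := (ih (two_pow_dvd_sub_of_coeff hcc hf hexact h)).add
      (two_pow_succ_dvd_displacement_sub hcc hf hexact h)
    rwa [sub_add_sub_cancel] at this

open Finset in
/-- If the first `2 ^ k` points of the orbit of `0` represent all residues modulo `2 ^ k`, then
`f^[2 ^ k] 0` is congruent to `2 ^ k` modulo `2 ^ (k + 1)`. -/
theorem two_pow_succ_dvd_iterate_two_pow_sub (hcc : Tendsto cc atTop (nhds 0))
    (hf : ∀ x : ℤ_[2], f x = c + ∑' i : ℕ, cc i * dig i x)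
    (hc : (2 : ℤ_[2]) ∣ c - 1) (h0 : (4 : ℤ_[2]) ∣ cc 0 - 1)
    (hexact : ∀ i : ℕ, (2 : ℤ_[2]) ^ (i + 1) ∣ cc i - 2 ^ i)
    {k : ℕ} (hk : ∀ z : ℤ_[2], ∃ n < 2 ^ k, (2 : ℤ_[2]) ^ k ∣ f^[n] 0 - z) :
    (2 : ℤ_[2]) ^ (k + 1) ∣ f^[2 ^ k] 0 - 2 ^ k := by
  have himage : (range (2 ^ k)).image (fun n => (f^[n] 0).appr k) = range (2 ^ k) := by
    ext m
    simp only [mem_image, mem_range]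
    constructor
    · rintro ⟨n, -, rfl⟩
      exact PadicInt.appr_lt _ k
    · intro hm
      obtain ⟨n, hn, h⟩ := hk m
      refine ⟨n, hn, Nat.ModEq.eq_of_lt_of_lt ?_ (PadicInt.appr_lt _ k) hm⟩
      rw [← two_pow_dvd_natCast_sub]
      simpa using h.sub (two_pow_dvd_sub_appr k (f^[n] 0))
  have hinj : Set.InjOn (fun n => (f^[n] 0).appr k) (range (2 ^ k)) :=
    injOn_of_card_image_eq (by rw [himage])
  have hdig {i : ℕ} (hi : i < k) :
      ∑ j ∈ range (2 ^ k), dig i (f^[j] 0) = (2 : ℤ_[2]) ^ (k - 1) := by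
    rw [sum_congr rfl fun j _ => dig_eq_of_dvd hi (two_pow_dvd_sub_appr k (f^[j] 0)),
      ← sum_image (f := fun m => ((m / 2 ^ i % 2 : ℕ) : ℤ_[2])) hinj, himage, ← Nat.cast_sum]
    obtain ⟨k, rfl⟩ := Nat.exists_eq_add_one_of_ne_zero (Nat.ne_zero_of_lt hi)
    rw [sum_range_two_pow_digit (Nat.lt_succ_iff.mp hi)]
    simp
  have htel : ∑ j ∈ range (2 ^ k), (f (f^[j] 0) - f^[j] 0) = f^[2 ^ k] 0 := by
    simp_rw [← Function.iterate_succ_apply' f]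
    rw [sum_range_sub (fun j => f^[j] 0)]
    simp
  have hsum := dvd_sum fun j (_ : j ∈ range (2 ^ k)) =>
    two_pow_succ_dvd_sub_sub hcc hf hexact k (f^[j] 0)
  rw [sum_sub_distrib, htel, sum_add_distrib, sum_comm] at hsum
  simp_rw [← mul_sum] at hsum
  rw [sum_congr (rfl : range k = range k) fun i hi => by rw [hdig (mem_range.mp hi)]] at hsum
  have hrest : (2 : ℤ_[2]) ^ (k + 1) ∣ ∑ i ∈ range k, (cc i - 2 ^ i) * 2 ^ (k - 1) := by
    refine dvd_sum fun i hi => ?_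
    obtain ⟨k, rfl⟩ := Nat.exists_eq_add_one_of_ne_zero (Nat.ne_zero_of_lt (mem_range.mp hi))
    rw [show k + 1 + 1 = 2 + k by ring, pow_add, Nat.add_sub_cancel]
    refine mul_dvd_mul_right ?_ _
    cases i with
    | zero => norm_num; exact h0
    | succ i => exact (pow_dvd_pow 2 (by omega)).trans (hexact (i + 1))
  have hconst : (2 : ℤ_[2]) ^ (k + 1) ∣ 2 ^ k * (c - 1) := by
    rw [pow_succ]
    exact mul_dvd_mul_left _ hc
  convert (hsum.add hrest).add hconst using 1
  simp
  ring

theorem exists_iterate_lt_two_pow (hcc : Tendsto cc atTop (nhds 0))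
    (hf : ∀ x : ℤ_[2], f x = c + ∑' i : ℕ, cc i * dig i x)
    (hc : (2 : ℤ_[2]) ∣ c - 1) (h0 : (4 : ℤ_[2]) ∣ cc 0 - 1)
    (hexact : ∀ i : ℕ, (2 : ℤ_[2]) ^ (i + 1) ∣ cc i - 2 ^ i)
    (k : ℕ) (z : ℤ_[2]) : ∃ n < 2 ^ k, (2 : ℤ_[2]) ^ k ∣ f^[n] 0 - z := by
  induction k generalizing z with
  | zero => exact ⟨0, by simp⟩
  | succ k ih =>
    obtain ⟨n, hn, h⟩ := ih z
    by_cases h' : (2 : ℤ_[2]) ^ (k + 1) ∣ f^[n] 0 - z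
    · exact ⟨n, hn.trans (Nat.pow_lt_pow_right one_lt_two k.lt_succ_self), h'⟩
    · refine ⟨n + 2 ^ k, by rw [pow_succ]; omega, ?_⟩
      have hy := two_pow_succ_dvd_iterate_two_pow_sub hcc hf hc h0 hexact ih
      have hy' : (2 : ℤ_[2]) ^ k ∣ f^[2 ^ k] 0 - 0 := by
        simpa using ((pow_dvd_pow 2 k.le_succ).trans hy).add (dvd_refl _)
      have h1 := two_pow_succ_dvd_iterate_displacement_sub hcc hf hexact hy' n
      have h2 := two_pow_succ_dvd_sub_of_dvd h h'
      have h3 : (2 : ℤ_[2]) ^ (k + 1) ∣ 2 * 2 ^ k := by rw [pow_succ']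
      rw [Function.iterate_add_apply]
      convert ((h1.add hy).add h2).add h3 using 1
      ring

end Converse

/-- The function `f x = c + Σ_{i≥0} c_i·δ_i(x)` (with `c_i → 0` 2-adically) is an ergodic
T-function (1-Lipschitz and transitive modulo `2^k` for every `k ≥ 1`) if and only if
(1) `c ≡ 1 (mod 2)`; (2) `c_0 ≡ 1 (mod 4)`; (3) `‖c_i‖ = 2^{-i}` for every `i ≥ 1`. -/
theorem ergodic_delta_series_criterion
    (c : ℤ_[2]) (cc : ℕ → ℤ_[2]) (hcc : Tendsto cc atTop (nhds 0))
    (f : ℤ_[2] → ℤ_[2]) (hf : ∀ x : ℤ_[2], f x = c + ∑' i : ℕ, cc i * dig i x) :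
    ((∀ a b : ℤ_[2], ‖f a - f b‖ ≤ ‖a - b‖) ∧
        ∀ k : ℕ, 1 ≤ k → TransitiveMod f k) ↔
      ((2 : ℤ_[2]) ∣ (c - 1) ∧
       (4 : ℤ_[2]) ∣ (cc 0 - 1) ∧
       ∀ i : ℕ, 1 ≤ i → ‖cc i‖ = (2 : ℝ) ^ (-(i : ℤ))) := by
  have hnorm : (4 : ℤ_[2]) ∣ cc 0 - 1 →
      ((∀ i : ℕ, 1 ≤ i → ‖cc i‖ = (2 : ℝ) ^ (-(i : ℤ))) ↔
        ∀ i : ℕ, (2 : ℤ_[2]) ^ (i + 1) ∣ cc i - 2 ^ i) := fun h0 => by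
    simp_rw [norm_eq_two_zpow_neg_iff]
    refine ⟨fun h i => ?_, fun h i _ => h i⟩
    obtain rfl | hi := Nat.eq_zero_or_pos i
    · simpa using (Dvd.intro 2 (by norm_num) : (2 : ℤ_[2]) ∣ 4).trans h0
    · exact h i hi
  constructor
  · rintro ⟨hL, hT⟩
    obtain ⟨hc, h0, hexact⟩ := coeff_conditions_of_ergodic hcc hf hL hT
    exact ⟨hc, h0, (hnorm h0).mpr hexact⟩
  · rintro ⟨hc, h0, h⟩
    have hexact := (hnorm h0).mp h
    have hL (a b : ℤ_[2]) : ‖f a - f b‖ ≤ ‖a - b‖ :=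
      norm_le_norm_of_forall_two_pow_dvd fun _ => two_pow_dvd_sub_of_coeff hcc hf hexact
    refine ⟨hL, fun k _ => (transitiveMod_iff hL k).mpr fun z => ?_⟩
    obtain ⟨n, -, hn⟩ := exists_iterate_lt_two_pow hcc hf hc h0 hexact k z
    exact ⟨n, hn⟩
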